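/- Let X be an infinite-dimensional complex Banach space. Then the set {T ∈ L(X) : T admits an almost-invariant halfspace of defect ≤ 1} is dense in L(X) with respect to the operator norm. -/

import Mathlib

/-- A halfspace of a Banach space `X`: a closed subspace of infinite dimension
and infinite codimension. -/
def IsHalfspace {X : Type*} [NormedAddCommGroup X] [NormedSpace ℂ X]
    (Y : Submodule ℂ X) : Prop :=
  IsClosed (Y : Set X) ∧ ¬FiniteDimensional ℂ Y ∧ ¬FiniteDimensional ℂ (X ⧸ Y)

/-- `T` admits an almost-invariant halfspace of defect at most 1. -/
def HasAIHS1 {X : Type*} [NormedAddCommGroup X] [NormedSpace ℂ X]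
    (T : X →L[ℂ] X) : Prop :=
  ∃ Y : Submodule ℂ X, IsHalfspace Y ∧
    ∃ E : Submodule ℂ X, FiniteDimensional ℂ E ∧ Module.finrank ℂ E ≤ 1 ∧
      ∀ y ∈ Y, T y ∈ Y ⊔ E


open Filter Topology BoundedContinuousFunction

section ApproximateEigenvalue

variable {E : Type*} [NormedAddCommGroup E] [NormedSpace ℂ E] [CompleteSpace E]

/-- If `S - lam` is bounded below and `lam` is in the closure of the resolvent set, then `lam` is in
the resolvent set. -/
theorem notMem_spectrum_of_bounded_below [Nontrivial E] (S : E →L[ℂ] E) {lam : ℂ} {δ : ℝ}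
    (hδ : 0 < δ) (hS : ∀ x, δ * ‖x‖ ≤ ‖S x - lam • x‖) (hlam : lam ∈ closure (spectrum ℂ S)ᶜ) :
    lam ∉ spectrum ℂ S := by
  obtain ⟨μ, hμ, hdist⟩ := Metric.mem_closure_iff.1 hlam (δ / 2) (half_pos hδ)
  rw [dist_eq_norm] at hdist
  obtain ⟨u, hu⟩ := spectrum.notMem_iff.1 hμ
  have hbelow : ∀ x, δ / 2 * ‖x‖ ≤ ‖(u : E →L[ℂ] E) x‖ := by
    intro x
    have h1 : S x - lam • x = -((u : E →L[ℂ] E) x) - (lam - μ) • x := by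
      rw [hu]
      simp [Algebra.algebraMap_eq_smul_one, sub_smul]
    have h2 : ‖(lam - μ) • x‖ ≤ δ / 2 * ‖x‖ := by
      rw [norm_smul]
      gcongr
    have h3 := norm_sub_le (-((u : E →L[ℂ] E) x)) ((lam - μ) • x)
    rw [← h1, norm_neg] at h3
    linarith [hS x]
  have hinv : ‖(↑u⁻¹ : E →L[ℂ] E)‖ ≤ (δ / 2)⁻¹ := by
    refine ContinuousLinearMap.opNorm_le_bound _ (by positivity) fun y => ?_
    have h1 := hbelow ((↑u⁻¹ : E →L[ℂ] E) y)
    have h2 : (u : E →L[ℂ] E) ((↑u⁻¹ : E →L[ℂ] E) y) = y := by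
      rw [← mul_apply_eq_comp, Units.mul_inv, one_apply_eq_self]
    rw [h2] at h1
    rw [inv_mul_eq_div, le_div_iff₀ (half_pos hδ)]
    linarith
  have hsmall : ‖(lam - μ) • (1 : E →L[ℂ] E)‖ < ‖(↑u⁻¹ : E →L[ℂ] E)‖⁻¹ := by
    rw [norm_smul, norm_one, mul_one]
    refine hdist.trans_le ?_
    rw [← inv_inv (δ / 2)]
    exact inv_anti₀ (norm_pos_iff.2 (Units.ne_zero _)) hinv
  refine spectrum.notMem_iff.2 ⟨u.add _ hsmall, ?_⟩
  rw [Units.val_add, hu]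
  simp [Algebra.algebraMap_eq_smul_one, sub_smul]

/-- Every bounded operator on a nontrivial complex Banach space has an approximate eigenvalue. -/
theorem exists_approximate_eigenvalue [Nontrivial E] (S : E →L[ℂ] E) :
    ∃ lam : ℂ, ∀ δ > 0, ∃ x, ‖S x - lam • x‖ < δ * ‖x‖ := by
  have hne : spectrum ℂ S ≠ Set.univ := fun h =>
    noncompact_univ ℂ (h ▸ spectrum.isCompact S)
  obtain ⟨lam, hlam⟩ := nonempty_frontier_iff.2 ⟨spectrum.nonempty S, hne⟩
  refine ⟨lam, fun δ hδ => ?_⟩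
  by_contra! h
  rw [frontier_eq_closure_inter_closure, (spectrum.isClosed S).closure_eq] at hlam
  exact notMem_spectrum_of_bounded_below S hδ h hlam.2 hlam.1

end ApproximateEigenvalue

section BoundedFamilies

variable {ι E : Type*} [TopologicalSpace ι] [NormedAddCommGroup E] [NormedSpace ℂ E]

/-- The bounded continuous functions that tend to zero along a filter. -/
noncomputable def nullFamilies (l : Filter ι) (E : Type*) [NormedAddCommGroup E] [NormedSpace ℂ E] :
    Submodule ℂ (ι →ᵇ E) where
  carrier := {u | Tendsto u l (𝓝 0)}
  add_mem' {u v} hu hv := by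
    rw [Set.mem_ofPred_eq, ← add_zero (0 : E)]
    exact Tendsto.add hu hv
  zero_mem' := tendsto_const_nhds
  smul_mem' c u hu := by simpa using Tendsto.const_smul hu c

theorem isClosed_nullFamilies (l : Filter ι) : IsClosed (nullFamilies l E : Set (ι →ᵇ E)) := by
  refine isClosed_of_closure_subset fun u hu => ?_
  refine Metric.tendsto_nhds.2 fun ε hε => ?_
  obtain ⟨v, hv, huv⟩ := Metric.mem_closure_iff.1 hu (ε / 2) (half_pos hε)
  filter_upwards [Metric.tendsto_nhds.1 hv (ε / 2) (half_pos hε)] with i hi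
  calc dist (u i) 0 ≤ dist (u i) (v i) + dist (v i) 0 := dist_triangle _ _ _
    _ < ε / 2 + ε / 2 := add_lt_add ((dist_coe_le_dist i).trans_lt huv) hi
    _ = ε := add_halves ε

/-- The bounded continuous functions that tend weakly to zero along a filter. -/
noncomputable def weaklyNullFamilies (l : Filter ι) (E : Type*) [NormedAddCommGroup E] [NormedSpace ℂ E] :
    Submodule ℂ (ι →ᵇ E) :=
  ⨅ f : E →L[ℂ] ℂ, (nullFamilies l ℂ).comap (f.compLeftContinuousBounded ι).toLinearMap

theorem mem_weaklyNullFamilies {l : Filter ι} {u : ι →ᵇ E} :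
    u ∈ weaklyNullFamilies l E ↔ ∀ f : E →L[ℂ] ℂ, Tendsto (fun i => f (u i)) l (𝓝 0) := by
  simp only [weaklyNullFamilies, Submodule.mem_iInf]
  rfl

theorem isClosed_weaklyNullFamilies (l : Filter ι) :
    IsClosed (weaklyNullFamilies l E : Set (ι →ᵇ E)) := by
  rw [weaklyNullFamilies, Submodule.coe_iInf]
  exact isClosed_iInter fun f =>
    (isClosed_nullFamilies l).preimage (f.compLeftContinuousBounded ι).continuous

/-- The operator on weakly null families induced by a bounded operator. -/
noncomputable def weaklyNullMap (l : Filter ι) (T : E →L[ℂ] E) :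
    weaklyNullFamilies l E →L[ℂ] weaklyNullFamilies l E :=
  (T.compLeftContinuousBounded ι).restrict fun _ hu =>
    mem_weaklyNullFamilies.2 fun f => mem_weaklyNullFamilies.1 hu (f.comp T)

/-- The null families, as a subspace of the weakly null families. -/
noncomputable def nullInWeaklyNull (l : Filter ι) (E : Type*) [NormedAddCommGroup E] [NormedSpace ℂ E] :
    Submodule ℂ (weaklyNullFamilies l E) :=
  (nullFamilies l E).comap (weaklyNullFamilies l E).subtype

theorem isClosed_nullInWeaklyNull (l : Filter ι) :
    IsClosed (nullInWeaklyNull l E : Set (weaklyNullFamilies l E)) :=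
  (isClosed_nullFamilies l).preimage continuous_subtype_val

/-- A family whose class modulo null families has norm `r` is frequently of norm at least `s`
for each `s < r`. -/
theorem frequently_le_norm_of_lt_norm_mk [DiscreteTopology ι] {l : Filter ι}
    (u : weaklyNullFamilies l E) {s : ℝ} (hs : 0 ≤ s)
    (h : s < ‖(nullInWeaklyNull l E).mkQ u‖) : ∃ᶠ i in l, s ≤ ‖(u : ι →ᵇ E) i‖ := by
  classical
  intro hev
  let m : ι →ᵇ E := BoundedContinuousFunction.ofNormedAddCommGroupDiscrete
    (fun i => if s ≤ ‖(u : ι →ᵇ E) i‖ then (u : ι →ᵇ E) i else 0) ‖(u : ι →ᵇ E)‖ (by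
      intro i
      split_ifs
      · exact norm_coe_le_norm _ i
      · simp)
  have hm0 : (fun _ => (0 : E)) =ᶠ[l] m := by
    filter_upwards [hev] with i hi
    exact (if_neg hi).symm
  have hm : Tendsto m l (𝓝 0) := tendsto_const_nhds.congr' hm0
  let m' : weaklyNullFamilies l E := ⟨m, mem_weaklyNullFamilies.2 fun f => by
    simpa [Function.comp_def] using (f.continuous.tendsto 0).comp hm⟩
  have hmem : m' ∈ nullInWeaklyNull l E := hm
  have heq : (nullInWeaklyNull l E).mkQ u = (nullInWeaklyNull l E).mkQ (u - m') := by
    have h0 : (nullInWeaklyNull l E).mkQ m' = 0 := (Submodule.Quotient.mk_eq_zero _).2 hmem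
    rw [map_sub, h0, sub_zero]
  have hle : ‖u - m'‖ ≤ s := by
    refine (norm_le hs).2 fun i => ?_
    change ‖(u : ι →ᵇ E) i - (if s ≤ ‖(u : ι →ᵇ E) i‖ then (u : ι →ᵇ E) i else 0)‖ ≤ s
    split_ifs with h
    · simpa using hs
    · simpa using (not_le.1 h).le
  rw [heq] at h
  exact absurd h (not_lt.2 ((Submodule.Quotient.norm_mk_le _ _).trans hle))

/-- If some bounded weakly null family is not null, then every operator has an approximate
eigenvalue whose approximate eigenvectors can be taken from a weakly null family. -/
theorem exists_weakly_null_approximate_eigenvalue [CompleteSpace E] [DiscreteTopology ι]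
    (l : Filter ι) (T : E →L[ℂ] E)
    (h : ∃ u ∈ weaklyNullFamilies l E, u ∉ nullFamilies l E) :
    ∃ lam : ℂ, ∀ (F : Finset (E →L[ℂ] ℂ)), ∀ δ > 0, ∃ x : E, x ≠ 0 ∧
      (∀ f ∈ F, ‖f x‖ ≤ δ * ‖x‖) ∧ ‖T x - lam • x‖ ≤ δ * ‖x‖ := by
  set N := nullInWeaklyNull l E with hN
  have : IsClosed (N : Set (weaklyNullFamilies l E)) := isClosed_nullInWeaklyNull l
  have : CompleteSpace (weaklyNullFamilies l E) :=
    (isClosed_weaklyNullFamilies l).completeSpace_coe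
  have : Nontrivial (weaklyNullFamilies l E ⧸ N) := by
    obtain ⟨u, hu, hu'⟩ := h
    exact ⟨⟨N.mkQ ⟨u, hu⟩, 0, fun h0 => hu' ((Submodule.Quotient.mk_eq_zero N).1 h0)⟩⟩
  let S : (weaklyNullFamilies l E ⧸ N) →L[ℂ] (weaklyNullFamilies l E ⧸ N) :=
    N.liftQL (N.mkQL.comp (weaklyNullMap l T)) fun u hu => by
      refine (Submodule.Quotient.mk_eq_zero N).2 ?_
      change Tendsto (fun i => T ((u : ι →ᵇ E) i)) l (𝓝 0)
      have hu' : Tendsto (u : ι →ᵇ E) l (𝓝 0) := hu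
      simpa [Function.comp_def] using (T.continuous.tendsto 0).comp hu'
  obtain ⟨lam, hlam⟩ := exists_approximate_eigenvalue (E := weaklyNullFamilies l E ⧸ N) S
  refine ⟨lam, fun F δ hδ => ?_⟩
  obtain ⟨q, hq⟩ := hlam (δ / 4) (by positivity)
  obtain ⟨u, rfl⟩ := N.mkQ_surjective q
  set r := ‖N.mkQ u‖ with hr
  have hr0 : 0 < r := by
    by_contra! h0
    have := norm_nonneg (S (N.mkQ u) - lam • N.mkQ u)
    nlinarith
  have hSu : S (N.mkQ u) - lam • N.mkQ u = N.mkQ (weaklyNullMap l T u - lam • u) := by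
    rw [map_sub, map_smul]
    rfl
  rw [hSu] at hq
  obtain ⟨v, hv, hvlt⟩ := Submodule.Quotient.norm_mk_lt
    (N.mkQ (weaklyNullMap l T u - lam • u)) (sub_pos.2 hq)
  rw [add_sub_cancel] at hvlt
  have hnull : Tendsto (fun i => T ((u : ι →ᵇ E) i) - lam • (u : ι →ᵇ E) i - (v : ι →ᵇ E) i)
      l (𝓝 0) := (Submodule.Quotient.eq N).1 hv.symm
  have hfreq := frequently_le_norm_of_lt_norm_mk u (half_pos hr0).le (half_lt_self hr0)
  have hF : ∀ᶠ i in l, ∀ f ∈ F, ‖f ((u : ι →ᵇ E) i)‖ < δ * (r / 2) := by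
    refine (Filter.eventually_all_finset F).2 fun f _ => ?_
    have := mem_weaklyNullFamilies.1 u.2 f
    simpa using Metric.tendsto_nhds.1 this (δ * (r / 2)) (by positivity)
  have hT : ∀ᶠ i in l, ‖T ((u : ι →ᵇ E) i) - lam • (u : ι →ᵇ E) i - (v : ι →ᵇ E) i‖
      < δ / 4 * r := by
    simpa using Metric.tendsto_nhds.1 hnull (δ / 4 * r) (by positivity)
  obtain ⟨i, hi, hFi, hTi⟩ := (hfreq.and_eventually (hF.and hT)).exists
  have hle : δ * (r / 2) ≤ δ * ‖(u : ι →ᵇ E) i‖ := by gcongr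
  refine ⟨(u : ι →ᵇ E) i, norm_pos_iff.1 (by linarith), fun f hf => (hFi f hf).le.trans hle,
    le_trans ?_ hle⟩
  have hvi : ‖(v : ι →ᵇ E) i‖ ≤ ‖v‖ := norm_coe_le_norm (v : ι →ᵇ E) i
  have := norm_le_norm_sub_add (T ((u : ι →ᵇ E) i) - lam • (u : ι →ᵇ E) i) ((v : ι →ᵇ E) i)
  linarith

end BoundedFamilies

section Construction

variable {X : Type*} [NormedAddCommGroup X] [NormedSpace ℂ X]

/-- Finitely many functionals on an infinite-dimensional space have a common unit zero. -/
theorem exists_norm_eq_one_forall_apply_eq_zero (hX : ¬FiniteDimensional ℂ X)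
    (F : Finset (X →L[ℂ] ℂ)) : ∃ x : X, ‖x‖ = 1 ∧ ∀ f ∈ F, f x = 0 := by
  let Φ : X →ₗ[ℂ] (F → ℂ) := LinearMap.pi fun f => (f : X →L[ℂ] ℂ).toLinearMap
  have hΦ : ¬Function.Injective Φ := fun h => hX (FiniteDimensional.of_injective Φ h)
  rw [← LinearMap.ker_eq_bot] at hΦ
  obtain ⟨x, hx, hx0⟩ := Submodule.exists_mem_ne_zero_of_ne_bot hΦ
  refine ⟨((‖x‖⁻¹ : ℝ) : ℂ) • x, ?_, fun f hf => ?_⟩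
  · simp [norm_smul, hx0]
  · have : f x = 0 := congrFun (LinearMap.mem_ker.1 hx) ⟨f, hf⟩
    simp [this]

theorem exists_approximate_eigenvalue_almost_annihilated [CompleteSpace X]
    (hX : ¬FiniteDimensional ℂ X) (T : X →L[ℂ] X) :
    ∃ lam : ℂ, ∀ (F : Finset (X →L[ℂ] ℂ)), ∀ δ > 0, ∃ x : X, x ≠ 0 ∧
      (∀ f ∈ F, ‖f x‖ ≤ δ * ‖x‖) ∧ ‖T x - lam • x‖ ≤ δ * ‖x‖ := by
  let _ : TopologicalSpace (Finset (X →L[ℂ] ℂ)) := ⊥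
  have : DiscreteTopology (Finset (X →L[ℂ] ℂ)) := ⟨rfl⟩
  choose u hu1 hu0 using exists_norm_eq_one_forall_apply_eq_zero hX
  refine exists_weakly_null_approximate_eigenvalue atTop T
    ⟨BoundedContinuousFunction.ofNormedAddCommGroupDiscrete u 1 fun F => (hu1 F).le,
      mem_weaklyNullFamilies.2 fun f => ?_, fun h => ?_⟩
  · refine tendsto_const_nhds.congr' ?_
    filter_upwards [eventually_ge_atTop {f}] with F hF
    exact (hu0 F f (hF (Finset.mem_singleton_self f))).symm
  · have h' : Tendsto u atTop (𝓝 0) := h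
    have h1 := h'.norm
    simp only [hu1, norm_zero] at h1
    exact one_ne_zero (tendsto_nhds_unique tendsto_const_nhds h1)

/-- Recursive construction of a sequence subject to conditions on its terms and on its pairs of
terms. -/
theorem exists_seq_of_forall_prefix_exists {α : Type*} [Nonempty α] (P : ℕ → α → Prop)
    (R : α → α → Prop)
    (h : ∀ (n : ℕ) (g : ℕ → α), (∀ i < n, P i (g i)) → (∀ i j, i < j → j < n → R (g i) (g j)) →
      ∃ y, P n y ∧ ∀ i < n, R (g i) y) :
    ∃ g : ℕ → α, (∀ n, P n (g n)) ∧ ∀ i j, i < j → R (g i) (g j) := by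
  classical
  have h' : ∀ (n : ℕ) (g : ℕ → α), ∃ y, (∀ i < n, P i (g i)) →
      (∀ i j, i < j → j < n → R (g i) (g j)) → P n y ∧ ∀ i < n, R (g i) y := by
    intro n g
    by_cases hg : (∀ i < n, P i (g i)) ∧ ∀ i j, i < j → j < n → R (g i) (g j)
    · obtain ⟨y, hy⟩ := h n g hg.1 hg.2
      exact ⟨y, fun _ _ => hy⟩
    · exact ⟨Classical.arbitrary α, fun h1 h2 => absurd ⟨h1, h2⟩ hg⟩
  choose next hnext using h'
  let G : ℕ → ℕ → α := fun n =>
    Nat.rec (fun _ => Classical.arbitrary α) (fun k g => Function.update g k (next k g)) n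
  have hG : ∀ n, G (n + 1) = Function.update (G n) n (next n (G n)) := fun _ => rfl
  have hstable : ∀ m k i, i < m → G (m + k) i = G m i := by
    intro m k i hi
    induction k with
    | zero => rfl
    | succ k ih =>
      rw [← add_assoc, hG, Function.update_of_ne (by omega), ih]
  have hinv : ∀ n, (∀ i < n, P i (G n i)) ∧ ∀ i j, i < j → j < n → R (G n i) (G n j) := by
    intro n
    induction n with
    | zero => exact ⟨fun i hi => absurd hi (by omega), fun i j _ hj => absurd hj (by omega)⟩
    | succ n ih =>
      obtain ⟨hP, hR⟩ := hnext n (G n) ih.1 ih.2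
      have hlt : ∀ i < n, G (n + 1) i = G n i := fun i hi => hstable n 1 i hi
      have heq : G (n + 1) n = next n (G n) := by rw [hG, Function.update_self]
      refine ⟨fun i hi => ?_, fun i j hij hj => ?_⟩
      · rcases Nat.lt_succ_iff_lt_or_eq.1 hi with hi | rfl
        · rw [hlt i hi]
          exact ih.1 i hi
        · rwa [heq]
      · rcases Nat.lt_succ_iff_lt_or_eq.1 hj with hj | rfl
        · rw [hlt i (hij.trans hj), hlt j hj]
          exact ih.2 i j hij hj
        · rw [hlt i hij, heq]
          exact hR i hij
  refine ⟨fun n => G (n + 1) n, fun n => (hinv (n + 1)).1 n (by omega), fun i j hij => ?_⟩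
  have hi : G (j + 1) i = G (i + 1) i := by
    obtain ⟨k, rfl⟩ := Nat.exists_eq_add_of_lt hij
    rw [show i + k + 1 + 1 = i + 1 + (k + 1) by omega]
    exact hstable (i + 1) (k + 1) i (by omega)
  change R (G (i + 1) i) (G (j + 1) j)
  rw [← hi]
  exact (hinv (j + 1)).2 i j hij (by omega)

/-- Extension of a finite biorthogonal system by an approximate eigenvector. -/
theorem exists_biorthogonal_extension (A : X →L[ℂ] X)
    (hA : ∀ (F : Finset (X →L[ℂ] ℂ)), ∀ δ > 0, ∃ x : X, x ≠ 0 ∧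
      (∀ f ∈ F, ‖f x‖ ≤ δ * ‖x‖) ∧ ‖A x‖ ≤ δ * ‖x‖)
    (s : Finset ℕ) (x : ℕ → X) (f : ℕ → X →L[ℂ] ℂ)
    (hxf : ∀ i ∈ s, ∀ j ∈ s, f i (x j) = if i = j then 1 else 0) {ε : ℝ} (hε : 0 < ε) :
    ∃ (y : X) (g : X →L[ℂ] ℂ), g y = 1 ∧ ‖g‖ * ‖A y‖ ≤ ε ∧
      ∀ i ∈ s, f i y = 0 ∧ g (x i) = 0 := by
  classical
  set C : ℝ := 1 + ∑ i ∈ s, ‖f i‖ * ‖x i‖ + ∑ i ∈ s, ‖x i‖ with hC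
  have hs1 : 0 ≤ ∑ i ∈ s, ‖f i‖ * ‖x i‖ := Finset.sum_nonneg fun i _ => by positivity
  have hs2 : 0 ≤ ∑ i ∈ s, ‖x i‖ := Finset.sum_nonneg fun i _ => by positivity
  have hC1 : 1 ≤ C := by linarith
  have hC0 : 0 < C := by linarith
  set M : ℝ := 2 * C * (1 + ‖A‖ * C) with hM
  have hM0 : 0 < M := by positivity
  set δ : ℝ := min (1 / (2 * C)) (ε / M) with hδ
  have hδ0 : 0 < δ := lt_min (by positivity) (by positivity)
  have hδC : δ * C ≤ 1 / 2 := by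
    have : δ * C ≤ 1 / (2 * C) * C := by gcongr; exact min_le_left _ _
    refine this.trans (le_of_eq ?_)
    field_simp
  have hδM : M * δ ≤ ε := by
    have : M * δ ≤ M * (ε / M) := by gcongr; exact min_le_right _ _
    refine this.trans (le_of_eq ?_)
    field_simp
  obtain ⟨z, hz1, hzf, hzA⟩ : ∃ z : X, ‖z‖ = 1 ∧ (∀ i ∈ s, ‖f i z‖ ≤ δ) ∧ ‖A z‖ ≤ δ := by
    obtain ⟨z, hz0, hzf, hzA⟩ := hA (s.image f) δ hδ0
    have hzn : 0 < ‖z‖ := norm_pos_iff.2 hz0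
    refine ⟨((‖z‖⁻¹ : ℝ) : ℂ) • z, by simp [norm_smul, hz0], fun i hi => ?_, ?_⟩
    · have := hzf _ (Finset.mem_image_of_mem f hi)
      rw [map_smul, norm_smul, Complex.norm_real, norm_inv, norm_norm, inv_mul_eq_div,
        div_le_iff₀ hzn]
      exact this
    · rw [map_smul, norm_smul, Complex.norm_real, norm_inv, norm_norm, inv_mul_eq_div,
        div_le_iff₀ hzn]
      exact hzA
  set w : X := ∑ i ∈ s, f i z • x i with hw
  have hwn : ‖w‖ ≤ δ * C := by
    calc ‖w‖ ≤ ∑ i ∈ s, ‖f i z • x i‖ := norm_sum_le _ _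
      _ ≤ ∑ i ∈ s, δ * ‖x i‖ := Finset.sum_le_sum fun i hi => by
          rw [norm_smul]
          gcongr
          exact hzf i hi
      _ = δ * ∑ i ∈ s, ‖x i‖ := by rw [Finset.mul_sum]
      _ ≤ δ * C := by gcongr; linarith
  set y : X := z - w with hy
  have hyn : 1 / 2 ≤ ‖y‖ := by
    have := norm_sub_norm_le z w
    rw [hz1] at this
    linarith
  have hy0 : y ≠ 0 := norm_pos_iff.1 (by linarith)
  have hfy : ∀ i ∈ s, f i y = 0 := by
    intro i hi
    rw [hy, hw, map_sub, map_sum, Finset.sum_congr rfl fun j hj => by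
      rw [map_smul, hxf i hi j hj]]
    simp [hi]
  have hAy : ‖A y‖ ≤ δ * (1 + ‖A‖ * C) := by
    calc ‖A y‖ ≤ ‖A z‖ + ‖A w‖ := by rw [hy, map_sub]; exact norm_sub_le _ _
      _ ≤ δ + ‖A‖ * (δ * C) := by
          gcongr
          exact (A.le_opNorm w).trans (by gcongr)
      _ = δ * (1 + ‖A‖ * C) := by ring
  obtain ⟨g₀, hg₀n, hg₀y⟩ : ∃ g₀ : X →L[ℂ] ℂ, ‖g₀‖ ≤ 2 ∧ g₀ y = 1 := by
    obtain ⟨φ, hφn, hφy⟩ := exists_dual_vector ℂ y (norm_ne_zero_iff.2 hy0)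
    refine ⟨((‖y‖⁻¹ : ℝ) : ℂ) • φ, ?_, ?_⟩
    · rw [norm_smul, hφn, mul_one, Complex.norm_real, norm_inv, norm_norm]
      exact inv_le_of_inv_le₀ (by norm_num) (by linarith)
    · simp [hφy, hy0]
  set g : X →L[ℂ] ℂ := g₀ - ∑ i ∈ s, g₀ (x i) • f i with hg
  have hgn : ‖g‖ ≤ 2 * C := by
    calc ‖g‖ ≤ ‖g₀‖ + ∑ i ∈ s, ‖g₀ (x i) • f i‖ :=
          (norm_sub_le _ _).trans (by gcongr; exact norm_sum_le _ _)
      _ ≤ 2 + ∑ i ∈ s, 2 * (‖f i‖ * ‖x i‖) := by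
          gcongr with i hi
          rw [norm_smul]
          calc ‖g₀ (x i)‖ * ‖f i‖ ≤ (2 * ‖x i‖) * ‖f i‖ := by
                gcongr
                exact (g₀.le_opNorm _).trans (by gcongr)
            _ = 2 * (‖f i‖ * ‖x i‖) := by ring
      _ = 2 * (1 + ∑ i ∈ s, ‖f i‖ * ‖x i‖) := by rw [← Finset.mul_sum]; ring
      _ ≤ 2 * C := by linarith
  refine ⟨y, g, ?_, ?_, fun i hi => ⟨hfy i hi, ?_⟩⟩
  · rw [hg, _root_.sub_apply, _root_.sum_apply, hg₀y,
      Finset.sum_eq_zero fun i hi => by simp [hfy i hi], sub_zero]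
  · calc ‖g‖ * ‖A y‖ ≤ (2 * C) * (δ * (1 + ‖A‖ * C)) := by gcongr
      _ = M * δ := by rw [hM]; ring
      _ ≤ ε := hδM
  · rw [hg, _root_.sub_apply, _root_.sum_apply,
      Finset.sum_congr rfl fun j hj => by
        rw [_root_.smul_apply, hxf j hj i hi]]
    simp [hi]

/-- An infinite biorthogonal system of approximate eigenvectors. -/
theorem exists_biorthogonal_sequence (A : X →L[ℂ] X)
    (hA : ∀ (F : Finset (X →L[ℂ] ℂ)), ∀ δ > 0, ∃ x : X, x ≠ 0 ∧
      (∀ f ∈ F, ‖f x‖ ≤ δ * ‖x‖) ∧ ‖A x‖ ≤ δ * ‖x‖)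
    {ε : ℕ → ℝ} (hε : ∀ n, 0 < ε n) :
    ∃ (x : ℕ → X) (f : ℕ → X →L[ℂ] ℂ), (∀ i j, f i (x j) = if i = j then 1 else 0) ∧
      ∀ n, ‖f n‖ * ‖A (x n)‖ ≤ ε n := by
  obtain ⟨g, hP, hR⟩ := exists_seq_of_forall_prefix_exists
    (fun n (p : X × (X →L[ℂ] ℂ)) => p.2 p.1 = 1 ∧ ‖p.2‖ * ‖A p.1‖ ≤ ε n)
    (fun p q => p.2 q.1 = 0 ∧ q.2 p.1 = 0) (by
      intro n g hP hR
      obtain ⟨y, φ, h1, h2, h3⟩ := exists_biorthogonal_extension A hA (Finset.range n)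
        (fun i => (g i).1) (fun i => (g i).2) (fun i hi j hj => by
          rw [Finset.mem_range] at hi hj
          rcases lt_trichotomy i j with h | rfl | h
          · rw [if_neg h.ne]
            exact (hR i j h hj).1
          · rw [if_pos rfl]
            exact (hP i hi).1
          · rw [if_neg h.ne']
            exact (hR j i h hi).2) (hε n)
      exact ⟨(y, φ), ⟨h1, h2⟩, fun i hi => h3 i (Finset.mem_range.2 hi)⟩)
  refine ⟨fun n => (g n).1, fun n => (g n).2, fun i j => ?_, fun n => (hP n).2⟩
  rcases lt_trichotomy i j with h | rfl | h
  · rw [if_neg h.ne]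
    exact (hR i j h).1
  · rw [if_pos rfl]
    exact (hP i).1
  · rw [if_neg h.ne']
    exact (hR j i h).2

theorem not_finiteDimensional_of_biorthogonal {V : Type*} [AddCommGroup V] [Module ℂ V]
    (v : ℕ → V) (φ : ℕ → V →ₗ[ℂ] ℂ) (h : ∀ i j, φ i (v j) = if i = j then 1 else 0) :
    ¬FiniteDimensional ℂ V := by
  intro hfin
  have hli : LinearIndependent ℂ v := by
    refine LinearIndependent.of_comp (LinearMap.pi φ) ?_
    have hv : LinearMap.pi φ ∘ v = fun j => Pi.single j (1 : ℂ) := by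
      funext j i
      simp [h, Pi.single_apply]
    rw [hv]
    exact Pi.linearIndependent_single_one ℕ ℂ
  have := hli.finite
  exact not_finite ℕ

/-- An operator with an infinite biorthogonal system of eigenvectors for one eigenvalue has an
almost-invariant halfspace. -/
theorem hasAIHS1_of_biorthogonal_eigenvectors (S : X →L[ℂ] X) (lam : ℂ) (x : ℕ → X)
    (f : ℕ → X →L[ℂ] ℂ) (hxf : ∀ i j, f i (x j) = if i = j then 1 else 0)
    (hS : ∀ n, S (x n) = lam • x n) : HasAIHS1 S := by
  set Y : Submodule ℂ X := (Submodule.span ℂ (Set.range fun n => x (2 * n))).topologicalClosure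
    with hY
  have hle : ∀ {W : Submodule ℂ X}, IsClosed (W : Set X) → (∀ n, x (2 * n) ∈ W) → Y ≤ W := by
    intro W hW h
    refine Submodule.topologicalClosure_minimal _ (Submodule.span_le.2 ?_) hW
    rintro _ ⟨n, rfl⟩
    exact h n
  have hxY : ∀ n, x (2 * n) ∈ Y := fun n =>
    Submodule.le_topologicalClosure _ (Submodule.subset_span ⟨n, rfl⟩)
  refine ⟨Y, ⟨Submodule.isClosed_topologicalClosure _, ?_, ?_⟩, ⊥, inferInstance, by simp,
    fun y hy => ?_⟩
  · refine not_finiteDimensional_of_biorthogonal (fun n => (⟨x (2 * n), hxY n⟩ : Y))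
      (fun n => (f (2 * n)).toLinearMap.comp Y.subtype) fun i j => ?_
    simp [hxf]
  · have hker : ∀ n, Y ≤ LinearMap.ker (f (2 * n + 1)).toLinearMap := fun n =>
      hle (f (2 * n + 1)).isClosed_ker fun m => by
        simp only [LinearMap.mem_ker, ContinuousLinearMap.coe_coe, hxf]
        exact if_neg (by omega)
    refine not_finiteDimensional_of_biorthogonal (fun n => Y.mkQ (x (2 * n + 1)))
      (fun n => Y.liftQ _ (hker n)) fun i j => ?_
    simp [hxf]
  · have hker : Y ≤ LinearMap.ker (S - lam • (1 : X →L[ℂ] X)).toLinearMap :=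
      hle (S - lam • (1 : X →L[ℂ] X)).isClosed_ker fun m => by
        simp [hS]
    have hSy : S y = lam • y := by
      simpa [sub_eq_zero] using hker hy
    rw [sup_bot_eq, hSy]
    exact Y.smul_mem lam hy

end Construction

/-- On an infinite-dimensional complex Banach space, the operators admitting an
AIHS of defect ≤ 1 are dense in `L(X)` for the operator norm. -/
theorem dense_aihs_operators
    {X : Type*} [NormedAddCommGroup X] [NormedSpace ℂ X] [CompleteSpace X]
    (hX : ¬FiniteDimensional ℂ X) :
    Dense {T : X →L[ℂ] X | HasAIHS1 T} := by
  refine fun T => Metric.mem_closure_iff.2 fun ε hε => ?_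
  obtain ⟨lam, hlam⟩ := exists_approximate_eigenvalue_almost_annihilated hX T
  set A : X →L[ℂ] X := T - lam • (1 : X →L[ℂ] X) with hA
  have hAx : ∀ x, A x = T x - lam • x := fun x => by simp [hA]
  obtain ⟨x, f, hxf, hsmall⟩ := exists_biorthogonal_sequence A
    (by simpa only [hAx] using hlam) (ε := fun n => ε / 2 / 2 / 2 ^ n) fun n => by positivity
  let k : ℕ → X →L[ℂ] X := fun n => (f n).smulRight (A (x n))
  have hk : ∀ n, ‖k n‖ ≤ ε / 2 / 2 / 2 ^ n := fun n => by
    simpa [k] using hsmall n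
  have hgeom : HasSum (fun n : ℕ => ε / 2 / 2 / 2 ^ n) (ε / 2) := hasSum_geometric_two' (ε / 2)
  have hsum : Summable k := Summable.of_norm_bounded hgeom.summable hk
  have hnorm : ‖∑' n, k n‖ ≤ ε / 2 := tsum_of_norm_bounded hgeom hk
  refine ⟨T - ∑' n, k n, hasAIHS1_of_biorthogonal_eigenvectors _ lam x f hxf fun j => ?_, ?_⟩
  · have hj : HasSum (fun n => k n (x j)) ((∑' n, k n) (x j)) :=
      hsum.hasSum.mapL (ContinuousLinearMap.apply ℂ X (x j))
    have hj' : HasSum (fun n => k n (x j)) (A (x j)) := by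
      convert hasSum_single j (f := fun n => k n (x j)) (fun n hn => ?_) using 1
      · simp [k, hxf]
      · simp [k, hxf, hn]
    rw [_root_.sub_apply, hj.unique hj', hAx, sub_sub_cancel]
  · rw [dist_eq_norm, sub_sub_cancel]
    linarith
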